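/- Let L be the face family generated by the facet list F0={1,2,4,6,9}, F1={3,5,7,8,9}, F2={0,6,7,8,10}, F3={2,3,4,8,9}, F4={0,1,2,5,6,10}, F5={3,4,7,8,10}, F6={1,5,6,7,9}, F7={0,1,2,4,8,10}, F8={3,5,6,7,10}, F9={0,2,6,7,8,9}, F10={1,3,4,5,9,10} (subsets of Fin 11), ordered by inclusion. Then L is a lattice, graded of length 5, Eulerian, and its numbers of elements of rank 1, 2, 3, 4 are 11, 35, 35, 11 respectively; in particular (11,35,35,11) is the f-vector of an Eulerian lattice of length 5. -/

import Mathlib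

/-- The face family generated by subsets `F 0, …, F (m-1)` of `Fin n`:
`Set.univ` together with all intersections over nonempty index sets. -/
def faceFamily {n m : ℕ} (F : Fin m → Set (Fin n)) : Set (Set (Fin n)) :=
  insert Set.univ {S | ∃ I : Set (Fin m), I.Nonempty ∧ S = ⋂ i ∈ I, F i}

/-- The facet list of the 3-sphere `(11⁰₃₅)`. -/
def facets : Fin 11 → Set (Fin 11) :=
  ![{1,2,4,6,9}, {3,5,7,8,9}, {0,6,7,8,10}, {2,3,4,8,9}, {0,1,2,5,6,10},
    {3,4,7,8,10}, {1,5,6,7,9}, {0,1,2,4,8,10}, {3,5,6,7,10}, {0,2,6,7,8,9},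
    {1,3,4,5,9,10}]

def fm : List ℕ := [598, 936, 1473, 796, 1127, 1432, 738, 1303, 1256, 965, 1594]
def R0 : List ℕ := [0]
def R1 : List ℕ := [1, 2, 4, 8, 16, 32, 64, 128, 256, 512, 1024]
def R2 : List ℕ := [5, 6, 18, 20, 24, 34, 40, 65, 66, 68, 96, 136, 160, 192, 257, 260, 264, 272, 384, 514, 516, 520, 528, 544, 576, 640, 768, 1025, 1026, 1032, 1040, 1056, 1088, 1152, 1280]
def R3 : List ℕ := [22, 69, 70, 98, 168, 224, 261, 276, 280, 392, 449, 530, 532, 536, 546, 552, 578, 580, 672, 704, 772, 776, 896, 1031, 1042, 1048, 1058, 1064, 1089, 1120, 1160, 1216, 1281, 1296, 1408]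
def R4 : List ℕ := [598, 738, 796, 936, 965, 1127, 1256, 1303, 1432, 1473, 1594]
def R5 : List ℕ := [2047]

def Ls : List ℕ := R0 ++ R1 ++ R2 ++ R3 ++ R4 ++ R5

def rr (m : ℕ) : ℕ :=
  bif R0.elem m then 0 else bif R1.elem m then 1 else bif R2.elem m then 2 else
  bif R3.elem m then 3 else bif R4.elem m then 4 else 5

def sub (a b : ℕ) : Bool := Nat.beq (Nat.land a b) a

def dec (m : ℕ) : Set (Fin 11) := {i | m.testBit i.val = true}

def fmask (i : Fin 11) : ℕ := fm.getD i.val 0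

theorem chk_lt : (Ls.all fun m => Nat.blt m 2048) = true := by decide +kernel

theorem chk_nodup : Ls.Nodup := by decide +kernel

theorem chk_meet : (fm.all fun a => Ls.all fun b => Ls.elem (Nat.land a b)) = true := by
  decide +kernel

theorem chk_fam : (Ls.all fun m => Nat.beq m 2047 || (fm.any fun a => sub m a) &&
    Nat.beq ((fm.filter fun a => sub m a).foldr Nat.land 2047) m) = true := by
  decide +kernel

theorem chk_cov : (Ls.all fun x => Ls.all fun y => !(sub x y) || Nat.beq x y ||
    Nat.beq (rr y) (rr x + 1) ||
    Ls.any fun z => sub x z && sub z y && !(Nat.beq x z) && !(Nat.beq z y)) = true := by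
  decide +kernel

theorem chk_euler : (Ls.all fun x => Ls.all fun y => !(sub x y) || Nat.beq x y ||
    Nat.beq ((Ls.filter fun z => sub x z && sub z y && Nat.beq (rr z % 2) 0).length)
     ((Ls.filter fun z => sub x z && sub z y && Nat.beq (rr z % 2) 1).length)) = true := by
  decide +kernel

theorem dec_sub {a b : ℕ} (ha : a < 2048) : dec a ⊆ dec b ↔ sub a b = true := by
  have h : sub a b = true ↔ a &&& b = a := by
    unfold sub; exact ⟨fun h => Nat.eq_of_beq_eq_true h, fun h => by rw [show Nat.land a b = a from h]; simp⟩
  rw [h]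
  constructor
  · intro h
    apply Nat.eq_of_testBit_eq
    intro i
    rw [Nat.testBit_and]
    by_cases hi : i < 11
    · have := @h ⟨i, hi⟩
      simp only [dec, Set.mem_ofPred_eq] at this
      cases h1 : a.testBit i <;> simp_all
    · have : a.testBit i = false :=
        Nat.testBit_lt_two_pow (lt_of_lt_of_le ha
          (by simpa using Nat.pow_le_pow_right (n := 2) (by norm_num) (not_lt.mp hi)))
      simp [this]
  · intro h i hi
    simp only [dec, Set.mem_ofPred_eq] at *
    rw [← h, Nat.testBit_and] at hi
    simp_all

theorem Ls_lt {m : ℕ} (h : m ∈ Ls) : m < 2048 := by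
  have := List.all_eq_true.mp chk_lt m h
  simpa [Nat.blt] using this

theorem dec_inj {a b : ℕ} (ha : a ∈ Ls) (hb : b ∈ Ls) (h : dec a = dec b) : a = b := by
  have h1 := (dec_sub (b := b) (Ls_lt ha)).mp h.le
  have h2 := (dec_sub (b := a) (Ls_lt hb)).mp h.ge
  have h1' : a &&& b = a := Nat.eq_of_beq_eq_true h1
  have h2' : b &&& a = b := Nat.eq_of_beq_eq_true h2
  rw [← h1', Nat.and_comm, h2']

theorem dec_and (a b : ℕ) : dec (a &&& b) = dec a ∩ dec b := by
  ext i; simp [dec, Nat.testBit_and]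

theorem dec_top : dec 2047 = Set.univ := by
  ext i; simp only [dec, Set.mem_ofPred_eq, Set.mem_univ, iff_true]; revert i; decide

theorem facets_eq (i : Fin 11) : facets i = dec (fmask i) := by
  ext j
  fin_cases i <;> simp only [facets, dec, Fin.zero_eta, Fin.mk_one, Fin.reduceFinMk,
    Matrix.cons_val, Matrix.cons_val_zero, Matrix.cons_val_one,
    Set.mem_insert_iff, Set.mem_singleton_iff, Set.mem_ofPred_eq] <;> revert j <;> decide

theorem fmask_mem (i : Fin 11) : fmask i ∈ fm := by
  revert i; decide

theorem fm_mem {a : ℕ} (h : a ∈ fm) : ∃ i, fmask i = a := by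
  revert a; decide

theorem mem_of_fam {S : Set (Fin 11)} (h : S ∈ faceFamily facets) : ∃ m ∈ Ls, dec m = S := by
  have key : ∀ I : Finset (Fin 11), ∃ m ∈ Ls, dec m = ⋂ i ∈ I, facets i := by
    intro I
    induction I using Finset.induction_on with
    | empty => exact ⟨2047, by decide +kernel, by simp [dec_top]⟩
    | insert i I hi ih =>
      obtain ⟨m, hm, e⟩ := ih
      refine ⟨fmask i &&& m, ?_, ?_⟩
      · have := List.all_eq_true.mp (List.all_eq_true.mp chk_meet _ (fmask_mem i)) m hm
        exact List.elem_iff.mp this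
      · rw [dec_and, e, Finset.set_biInter_insert, facets_eq]
  rcases h with rfl | ⟨I, -, rfl⟩
  · exact ⟨2047, by decide +kernel, dec_top⟩
  · classical
    obtain ⟨m, hm, e⟩ := key I.toFinset
    exact ⟨m, hm, by simpa using e⟩

theorem dec_foldr (l : List ℕ) : dec (l.foldr Nat.land 2047) = ⋂ a ∈ l, dec a := by
  induction l with
  | nil => simp [dec_top]
  | cons a l ih =>
    have : dec (Nat.land a (l.foldr Nat.land 2047)) = _ := dec_and _ _
    rw [List.foldr_cons, this, ih]
    ext; simp

theorem fam_of_mem {m : ℕ} (h : m ∈ Ls) : dec m ∈ faceFamily facets := by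
  have := List.all_eq_true.mp chk_fam m h
  rw [Bool.or_eq_true, Bool.and_eq_true] at this
  rcases this with h | ⟨h1, h2⟩
  · left; rw [Nat.eq_of_beq_eq_true h, dec_top]
  · right
    obtain ⟨a, ha, hs⟩ := List.any_eq_true.mp h1
    obtain ⟨i, rfl⟩ := fm_mem ha
    refine ⟨{i | sub m (fmask i) = true}, ⟨i, hs⟩, ?_⟩
    conv_lhs => rw [← Nat.eq_of_beq_eq_true h2, dec_foldr]
    ext j
    simp only [Set.mem_iInter, List.mem_filter, Set.mem_ofPred_eq, facets_eq]
    constructor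
    · intro H i hi
      exact H _ ⟨fmask_mem i, hi⟩
    · rintro H a ⟨ha, hs⟩
      obtain ⟨i, rfl⟩ := fm_mem ha
      exact H i hs

noncomputable def enc (z : ↥(faceFamily facets)) : ℕ := (mem_of_fam z.2).choose

theorem enc_mem (z : ↥(faceFamily facets)) : enc z ∈ Ls := (mem_of_fam z.2).choose_spec.1

theorem dec_enc (z : ↥(faceFamily facets)) : dec (enc z) = z.1 := (mem_of_fam z.2).choose_spec.2

theorem enc_inj : Function.Injective enc := by
  intro a b h
  apply Subtype.ext
  rw [← dec_enc, ← dec_enc, h]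

theorem enc_surj {m : ℕ} (h : m ∈ Ls) : ∃ z, enc z = m :=
  ⟨⟨dec m, fam_of_mem h⟩, dec_inj (enc_mem _) h (dec_enc _)⟩

theorem enc_le (a b : ↥(faceFamily facets)) : a ≤ b ↔ sub (enc a) (enc b) = true := by
  rw [← dec_sub (Ls_lt (enc_mem a)), dec_enc, dec_enc]; rfl

theorem count (p : ℕ → Bool) (s : Set ↥(faceFamily facets))
    (hs : ∀ z, z ∈ s ↔ p (enc z) = true) : s.ncard = (Ls.filter p).length := by
  have h : enc '' s = ((Ls.filter p).toFinset : Set ℕ) := by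
    ext m
    simp only [Set.mem_image, List.coe_toFinset, List.mem_filter, Set.mem_ofPred_eq]
    constructor
    · rintro ⟨z, hz, rfl⟩
      exact ⟨enc_mem z, (hs z).mp hz⟩
    · rintro ⟨hm, hp⟩
      obtain ⟨z, rfl⟩ := enc_surj hm
      exact ⟨z, (hs z).mpr hp, rfl⟩
  rw [← Set.ncard_image_of_injective s enc_inj, h, Set.ncard_coe_finset,
    List.toFinset_card_of_nodup (chk_nodup.filter p)]

theorem countRk (k c : ℕ) (h : (Ls.filter fun m => Nat.beq (rr m) k).length = c) :
    {z : ↥(faceFamily facets) | rr (enc z) = k}.ncard = c := by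
  rw [← h]
  apply count
  intro z
  simp

theorem has_lub (a b : ↥(faceFamily facets)) : ∃ c : ↥(faceFamily facets), IsLUB {a, b} c := by
  have hc : (⋂ i ∈ {i | a.1 ⊆ facets i ∧ b.1 ⊆ facets i}, facets i) ∈ faceFamily facets := by
    rcases Set.eq_empty_or_nonempty {i | a.1 ⊆ facets i ∧ b.1 ⊆ facets i} with h | h
    · left; rw [h]; simp
    · right; exact ⟨_, h, rfl⟩
  refine ⟨⟨_, hc⟩, ?_, ?_⟩
  · rintro z (rfl | rfl)
    · exact Set.subset_iInter₂ fun i hi => hi.1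
    · exact Set.subset_iInter₂ fun i hi => hi.2
  · rintro ⟨z, hz⟩ hu
    have ha : a.1 ⊆ z := hu (Set.mem_insert _ _)
    have hb : b.1 ⊆ z := hu (Set.mem_insert_of_mem _ rfl)
    change (⋂ i ∈ {i | a.1 ⊆ facets i ∧ b.1 ⊆ facets i}, facets i) ⊆ z
    rcases hz with rfl | ⟨I, -, rfl⟩
    · exact Set.subset_univ _
    · refine Set.subset_iInter₂ fun i hi => Set.biInter_subset_of_mem ?_
      exact ⟨ha.trans (Set.biInter_subset_of_mem hi), hb.trans (Set.biInter_subset_of_mem hi)⟩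

theorem has_glb (a b : ↥(faceFamily facets)) : ∃ c : ↥(faceFamily facets), IsGLB {a, b} c := by
  have hc : a.1 ∩ b.1 ∈ faceFamily facets := by
    obtain ⟨a, ha⟩ := a
    obtain ⟨b, hb⟩ := b
    rcases id ha with rfl | ⟨I, hI, rfl⟩
    · simpa using hb
    · rcases hb with rfl | ⟨J, hJ, rfl⟩
      · simpa using ha
      · right
        exact ⟨I ∪ J, hI.inl, (Set.biInter_union _ _ _).symm⟩
  refine ⟨⟨_, hc⟩, ?_, ?_⟩
  · rintro z (rfl | rfl)
    · exact Set.inter_subset_left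
    · exact Set.inter_subset_right
  · intro z hu
    exact Set.subset_inter (hu (Set.mem_insert _ _)) (hu (Set.mem_insert_of_mem _ rfl))

/-- The face family of `(11⁰₃₅)`, ordered by inclusion, is a lattice,
graded of length 5, Eulerian, and has 11, 35, 35, 11 elements of
rank 1, 2, 3, 4 respectively: `(11,35,35,11)` is the f-vector of an
Eulerian lattice of length 5. -/
theorem lattice_11_35_35_11 :
    (∀ a b : ↥(faceFamily facets), ∃ c : ↥(faceFamily facets), IsLUB {a, b} c) ∧
    (∀ a b : ↥(faceFamily facets), ∃ c : ↥(faceFamily facets), IsGLB {a, b} c) ∧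
    ∃ rk : ↥(faceFamily facets) → ℕ,
      (∃ bot top : ↥(faceFamily facets),
        (∀ z, bot ≤ z ∧ z ≤ top) ∧ rk bot = 0 ∧ rk top = 5) ∧
      (∀ x y : ↥(faceFamily facets), x ⋖ y → rk y = rk x + 1) ∧
      (∀ x y : ↥(faceFamily facets), x < y →
        {z ∈ Set.Icc x y | Even (rk z)}.ncard = {z ∈ Set.Icc x y | Odd (rk z)}.ncard) ∧
      {z | rk z = 1}.ncard = 11 ∧ {z | rk z = 2}.ncard = 35 ∧
      {z | rk z = 3}.ncard = 35 ∧ {z | rk z = 4}.ncard = 11 := by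
  refine ⟨has_lub, has_glb, fun z => rr (enc z), ?_, ?_, ?_, countRk 1 11 (by decide +kernel),
    countRk 2 35 (by decide +kernel), countRk 3 35 (by decide +kernel),
    countRk 4 11 (by decide +kernel)⟩
  · obtain ⟨bot, hb⟩ := enc_surj (m := 0) (by decide +kernel)
    obtain ⟨top, ht⟩ := enc_surj (m := 2047) (by decide +kernel)
    refine ⟨bot, top, fun z => ⟨?_, ?_⟩, ?_, ?_⟩
    · change bot.1 ⊆ z.1
      rw [← dec_enc bot, hb]
      intro i hi
      simp [dec] at hi
    · change z.1 ⊆ top.1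
      rw [← dec_enc top, ht, dec_top]
      exact Set.subset_univ _
    · change rr (enc bot) = 0
      rw [hb]; decide +kernel
    · change rr (enc top) = 5
      rw [ht]; decide +kernel
  · intro x y hxy
    have := List.all_eq_true.mp (List.all_eq_true.mp chk_cov _ (enc_mem x)) _ (enc_mem y)
    simp only [Bool.or_eq_true] at this
    rcases this with ((h | h) | h) | h
    · rw [(enc_le x y).mp hxy.le] at h; simp at h
    · exact absurd (enc_inj (Nat.eq_of_beq_eq_true h)) hxy.ne
    · exact Nat.eq_of_beq_eq_true h
    · obtain ⟨m, hm, h⟩ := List.any_eq_true.mp h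
      obtain ⟨z, rfl⟩ := enc_surj hm
      simp only [Bool.and_eq_true, ← enc_le, Bool.not_eq_true'] at h
      obtain ⟨⟨⟨h1, h2⟩, h3⟩, h4⟩ := h
      exact absurd (lt_of_le_of_ne h2 fun e => by simp [e] at h4)
        (hxy.2 (lt_of_le_of_ne h1 fun e => by simp [e] at h3))
  · intro x y hxy
    have := List.all_eq_true.mp (List.all_eq_true.mp chk_euler _ (enc_mem x)) _ (enc_mem y)
    simp only [Bool.or_eq_true] at this
    rcases this with (h | h) | h
    · rw [(enc_le x y).mp hxy.le] at h; simp at h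
    · exact absurd (enc_inj (Nat.eq_of_beq_eq_true h)) hxy.ne
    · have h' := Nat.eq_of_beq_eq_true h
      refine (count _ _ (fun z => ?_)).trans (h'.trans (count _ _ (fun z => ?_)).symm)
      · simp only [Set.mem_ofPred_eq, Set.mem_Icc, Bool.and_eq_true, enc_le, Nat.beq_eq,
          Nat.even_iff]
      · simp only [Set.mem_ofPred_eq, Set.mem_Icc, Bool.and_eq_true, enc_le, Nat.beq_eq,
          Nat.odd_iff]
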